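/- arXiv:2407.04857 — 2 statements merged into one kernel-verified Lean document; each statement's English description precedes it below -/
import Mathlib

section
/- In the Example-2 economy, the matching m^L that matches a2–b2 in period 1 and a1–b3, a3–b1, a4–b4 in period 2 is dynamically stable (m^L ∈ DS_2) but is not CVR-dynamically stable (m^L ∉ D̂S_2). -/
/-!
A framework for two-sided, one-to-one, irreversible dynamic matching markets
with conjectures, following Doval's "A framework for (dynamic) stability".

Periods are indexed `0, …, T-1` (the paper's periods `1, …, T`).
-/

namespace DynMatch

open Classical

noncomputable section

/-- A length-`T` two-sided dynamic economy: the arrivals on each side in each period. -/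
structure Economy (A B : Type) where
  T : ℕ
  arrA : ℕ → Finset A
  arrB : ℕ → Finset B

/-- Validity of an economy: positive length, pairwise disjoint arrivals, and
no arrivals outside the horizon. -/
def Economy.Valid {A B : Type} (E : Economy A B) : Prop :=
  0 < E.T ∧
  (∀ s t, s ≠ t → Disjoint (E.arrA s) (E.arrA t)) ∧
  (∀ s t, s ≠ t → Disjoint (E.arrB s) (E.arrB t)) ∧
  (∀ s, E.T ≤ s → E.arrA s = ∅) ∧ (∀ s, E.T ≤ s → E.arrB s = ∅)

/-- A raw dynamic matching: in every period, a partial pairing between the two sides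
(`none` means unmatched, i.e. matched to oneself). -/
structure PreMatching (A B : Type) where
  mA : ℕ → A → Option B
  mB : ℕ → B → Option A

variable {A B : Type} [DecidableEq A] [DecidableEq B]

/-- Side-`A` agents having arrived up to (and including) period `t`. -/
def arrAUpTo (E : Economy A B) (t : ℕ) : Finset A := (Finset.range (t+1)).biUnion E.arrA

/-- Side-`B` agents having arrived up to (and including) period `t`. -/
def arrBUpTo (E : Economy A B) (t : ℕ) : Finset B := (Finset.range (t+1)).biUnion E.arrB

/-- `m` is an irreversible dynamic matching for the economy `E`: in every period it is
an involutive pairing between arrived agents of the two sides, and once matched a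
pair stays matched. -/
def IsMatching (E : Economy A B) (m : PreMatching A B) : Prop :=
  (∀ t a b, t < E.T → (m.mA t a = some b ↔ m.mB t b = some a)) ∧
  (∀ t a, t < E.T → m.mA t a ≠ none → a ∈ arrAUpTo E t) ∧
  (∀ t a b, t < E.T → m.mA t a = some b → b ∈ arrBUpTo E t) ∧
  (∀ t s a, t ≤ s → s < E.T → m.mA t a ≠ none → m.mA s a = m.mA t a) ∧
  (∀ t s b, t ≤ s → s < E.T → m.mB t b ≠ none → m.mB s b = m.mB t b)

/-- The everywhere-unmatched prematching. -/
def emptyM : PreMatching A B := ⟨fun _ _ => none, fun _ _ => none⟩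

/-- An agent of the economy: a side-`A` or a side-`B` agent. -/
abbrev Agent (A B : Type) := A ⊕ B

/-- `𝒜_t(m^{t-1})`: side-`A` agents available to match in period `t` given history `m`. -/
def availA (E : Economy A B) (m : PreMatching A B) (t : ℕ) : Finset A :=
  (arrAUpTo E t).filter fun a => ∀ s, s < t → m.mA s a = none

/-- `ℬ_t(m^{t-1})`: side-`B` agents available to match in period `t` given history `m`. -/
def availB (E : Economy A B) (m : PreMatching A B) (t : ℕ) : Finset B :=
  (arrBUpTo E t).filter fun b => ∀ s, s < t → m.mB s b = none

/-- `k ∈ 𝒜_t(m^{t-1}) ∪ ℬ_t(m^{t-1})`. -/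
def isAvail (E : Economy A B) (m : PreMatching A B) (t : ℕ) : Agent A B → Prop
  | Sum.inl a => a ∈ availA E m t
  | Sum.inr b => b ∈ availB E m t

/-- `k ∈ A_1 ∪ B_1`: `k` is a first-period arrival. -/
def inPeriodOne (E : Economy A B) : Agent A B → Prop
  | Sum.inl a => a ∈ E.arrA 0
  | Sum.inr b => b ∈ E.arrB 0

/-- `m_t(k) = k`: agent `k` is unmatched in period `t` under `m`. -/
def unmatchedAt (m : PreMatching A B) (t : ℕ) : Agent A B → Prop
  | Sum.inl a => m.mA t a = none
  | Sum.inr b => m.mB t b = none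

/-- `m` and `m'` agree in all periods `s < t` (i.e. they share the history `m^{t-1}`). -/
def agreeUpTo (m m' : PreMatching A B) (t : ℕ) : Prop :=
  ∀ s, s < t → (∀ a, m.mA s a = m'.mA s a) ∧ (∀ b, m.mB s b = m'.mB s b)

/-- Agent `k` is unmatched through period `t` (all periods `s ≤ t`) under `m`. -/
def unmatchedThrough (m : PreMatching A B) (t : ℕ) : Agent A B → Prop
  | Sum.inl a => ∀ s, s ≤ t → m.mA s a = none
  | Sum.inr b => ∀ s, s ≤ t → m.mB s b = none

/-- `M_T(m^{t-1})`: matchings of `E` agreeing with `m` through period `t-1`. -/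
def MSetH (E : Economy A B) (m : PreMatching A B) (t : ℕ) : Set (PreMatching A B) :=
  {m' | IsMatching E m' ∧ agreeUpTo m m' t}

/-- `M_T(m^{t-1}, k)`: matchings of `E` agreeing with `m` through period `t-1` and
leaving `k` unmatched through period `t`. -/
def MSet (E : Economy A B) (m : PreMatching A B) (t : ℕ) (k : Agent A B) :
    Set (PreMatching A B) :=
  {m' | IsMatching E m' ∧ agreeUpTo m m' t ∧ unmatchedThrough m' t k}

/-- Preferences: Bernoulli utilities on both sides and discount factors.
(The payoff of remaining single is normalized to `0`.) -/
structure Pref (A B : Type) where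
  u : A → B → ℝ
  v : A → B → ℝ
  dA : A → ℝ
  dB : B → ℝ

/-- Discount factors lie in `[0,1]`. -/
def Pref.Valid (P : Pref A B) : Prop :=
  (∀ a, 0 ≤ P.dA a ∧ P.dA a ≤ 1) ∧ (∀ b, 0 ≤ P.dB b ∧ P.dB b ≤ 1)

/-- `t_m(a)`: the first period `s ≥ t` at which `a` is matched under `m` (`T` if never). -/
def matchTimeA (E : Economy A B) (m : PreMatching A B) (t : ℕ) (a : A) : ℕ :=
  min (sInf {s | t ≤ s ∧ m.mA s a ≠ none}) E.T

/-- `t_m(b)`: the first period `s ≥ t` at which `b` is matched under `m` (`T` if never). -/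
def matchTimeB (E : Economy A B) (m : PreMatching A B) (t : ℕ) (b : B) : ℕ :=
  min (sInf {s | t ≤ s ∧ m.mB s b ≠ none}) E.T

/-- `U_t(a,m) = δ_a^{t_m(a)-t}·u(a, m_T(a))` (and `0` if `a` ends up unmatched). -/
def Upay (P : Pref A B) (E : Economy A B) (m : PreMatching A B) (t : ℕ) (a : A) : ℝ :=
  match m.mA (E.T - 1) a with
  | none => 0
  | some b => P.dA a ^ (matchTimeA E m t a - t) * P.u a b

/-- `V_t(b,m) = δ_b^{t_m(b)-t}·v(m_T(b), b)` (and `0` if `b` ends up unmatched). -/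
def Vpay (P : Pref A B) (E : Economy A B) (m : PreMatching A B) (t : ℕ) (b : B) : ℝ :=
  match m.mB (E.T - 1) b with
  | none => 0
  | some a => P.dB b ^ (matchTimeB E m t b - t) * P.v a b

/-- A family of conjectures `Φ`: for every period `t`, history `m^{t-1}` and agent `k`,
a set `φ_t(m^{t-1},k)` of matchings `k` considers possible upon remaining unmatched. -/
abbrev ConjFam (A B : Type) := ℕ → PreMatching A B → Agent A B → Set (PreMatching A B)

/-- Validity of a family of conjectures for `E`: conjectures are (nonempty) subsets of
`M_T(m^{t-1},k)` and depend on the matching only through the history `m^{t-1}`. -/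
def ConjFam.Valid (E : Economy A B) (φ : ConjFam A B) : Prop :=
  (∀ t m k, φ t m k ⊆ MSet E m t k) ∧
  (∀ t m m' k, agreeUpTo m m' t → φ t m k = φ t m' k) ∧
  (∀ t m k, t < E.T → IsMatching E m → isAvail E m t k → (φ t m k).Nonempty)

/-- `m` is a `Φ`-solution for `E` (Definition 3): in every period, every available agent
weakly prefers `m` to some conjectured matching, and no available pair blocks. -/
def IsSolution (P : Pref A B) (E : Economy A B) (φ : ConjFam A B)
    (m : PreMatching A B) : Prop :=
  IsMatching E m ∧
  ∀ t, t < E.T →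
    ((∀ a ∈ availA E m t, ∃ m' ∈ φ t m (Sum.inl a), Upay P E m' t a ≤ Upay P E m t a) ∧
     (∀ b ∈ availB E m t, ∃ m' ∈ φ t m (Sum.inr b), Vpay P E m' t b ≤ Vpay P E m t b) ∧
     (∀ a ∈ availA E m t, ∀ b ∈ availB E m t,
        ¬(P.u a b > Upay P E m t a ∧ P.v a b > Vpay P E m t b)))

/-- `Σ^Φ_T(E)`: the set of `Φ`-solutions of `E`. -/
def SolSet (P : Pref A B) (E : Economy A B) (φ : ConjFam A B) : Set (PreMatching A B) :=
  {m | IsSolution P E φ m}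

/-- The static (Gale–Shapley) notion of stability, for length-1 economies:
individual rationality plus absence of blocking pairs. -/
def Stable1 (P : Pref A B) (E : Economy A B) (m : PreMatching A B) : Prop :=
  IsMatching E m ∧
  (∀ a b, m.mA (E.T - 1) a = some b → 0 ≤ P.u a b) ∧
  (∀ b a, m.mB (E.T - 1) b = some a → 0 ≤ P.v a b) ∧
  (∀ a ∈ E.arrA 0, ∀ b ∈ E.arrB 0,
     ¬(P.u a b > Upay P E m 0 a ∧ P.v a b > Vpay P E m 0 b))

/-- The worst (minimal) period-`t` payoff of `a` over the set `C (inl a)` of matchings. -/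
def wA (P : Pref A B) (E : Economy A B) (t : ℕ)
    (C : Agent A B → Set (PreMatching A B)) (a : A) : ℝ :=
  sInf ((fun m' => Upay P E m' t a) '' C (Sum.inl a))

/-- The worst (minimal) period-`t` payoff of `b` over the set `C (inr b)` of matchings. -/
def wB (P : Pref A B) (E : Economy A B) (t : ℕ)
    (C : Agent A B → Set (PreMatching A B)) (b : B) : ℝ :=
  sInf ((fun m' => Vpay P E m' t b) '' C (Sum.inr b))

/-- Utility of side-`A` agent `a` in the induced one-period economy with outside
option value `W a` (truncated preferences). -/
def indU (P : Pref A B) (W : A → ℝ) (a : A) : Option B → ℝ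
  | none => W a
  | some b => P.u a b

/-- Utility of side-`B` agent `b` in the induced one-period economy with outside
option value `W b` (truncated preferences). -/
def indV (P : Pref A B) (W : B → ℝ) (b : B) : Option A → ℝ
  | none => W b
  | some a => P.v a b

/-- The period-`t` component of `mbar` is a stable matching of the one-period economy
`E_{t,φ}(m^{t-1})` induced by the conjecture profile `C` (Definition 6): matching among
the available agents, individually rational w.r.t. the worst-conjecture thresholds,
and without blocking pairs in the truncated preferences. -/
def StableInduced (P : Pref A B) (E : Economy A B) (m : PreMatching A B) (t : ℕ)
    (C : Agent A B → Set (PreMatching A B)) (mbar : PreMatching A B) : Prop :=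
  (∀ a ∈ availA E m t, ∀ b, mbar.mA t a = some b → b ∈ availB E m t ∧ mbar.mB t b = some a) ∧
  (∀ b ∈ availB E m t, ∀ a, mbar.mB t b = some a → a ∈ availA E m t ∧ mbar.mA t a = some b) ∧
  (∀ a ∈ availA E m t, ∀ b, mbar.mA t a = some b → wA P E t C a ≤ P.u a b) ∧
  (∀ b ∈ availB E m t, ∀ a, mbar.mB t b = some a → wB P E t C b ≤ P.v a b) ∧
  (∀ a ∈ availA E m t, ∀ b ∈ availB E m t,
     ¬(P.u a b > indU P (wA P E t C) a (mbar.mA t a) ∧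
       P.v a b > indV P (wB P E t C) b (mbar.mB t b)))

/-- `mbar_t` is stable among those who match in period `t` relative to the conjecture
profile `C` (Definition 7): every available agent matched in period `t` weakly prefers
its partner to its worst conjectured matching, and no pair of agents both matched in
period `t` blocks. -/
def StableAmongMatched (P : Pref A B) (E : Economy A B) (m : PreMatching A B) (t : ℕ)
    (C : Agent A B → Set (PreMatching A B)) (mbar : PreMatching A B) : Prop :=
  (∀ a ∈ availA E m t, ∀ b, mbar.mA t a = some b → wA P E t C a ≤ P.u a b) ∧
  (∀ b ∈ availB E m t, ∀ a, mbar.mB t b = some a → wB P E t C b ≤ P.v a b) ∧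
  (∀ a ∈ availA E m t, ∀ b ∈ availB E m t, ∀ b' a',
     mbar.mA t a = some b' → mbar.mB t b = some a' →
     ¬(P.u a b > P.u a b' ∧ P.v a b > P.v a' b))

/-- `E_t^T(m^{t-1})`: the continuation economy starting at period `t` given history `m`:
its first-period arrivals are the agents available at `t`, later arrivals are unchanged. -/
def contEconomy (E : Economy A B) (m : PreMatching A B) (t : ℕ) : Economy A B where
  T := E.T - t
  arrA := fun s => if s = 0 then availA E m t else E.arrA (t + s)
  arrB := fun s => if s = 0 then availB E m t else E.arrB (t + s)

/-- The restriction of `m` to the continuation economy starting in period `t`: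
time is shifted by `t` and agents matched strictly before `t` are dropped. -/
def restrictM (m : PreMatching A B) (t : ℕ) : PreMatching A B where
  mA := fun s a => if ∀ s', s' < t → m.mA s' a = none then m.mA (t + s) a else none
  mB := fun s b => if ∀ s', s' < t → m.mB s' b = none then m.mB (t + s) b else none

/-- The matching of the original economy corresponding to history `m` through period
`t-1` followed by the continuation matching `m'` (indexed from `0`) of the
continuation economy. -/
def splice (m m' : PreMatching A B) (t : ℕ) : PreMatching A B where
  mA := fun s a => if s < t then m.mA s a
    else if ∀ s', s' < t → m.mA s' a = none then m'.mA (s - t) a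
    else m.mA (t - 1) a
  mB := fun s b => if s < t then m.mB s b
    else if ∀ s', s' < t → m.mB s' b = none then m'.mB (s - t) b
    else m.mB (t - 1) b

/-- The family of conjectures that the family `φ` of the original economy induces on the
continuation economy `E_t^T(m^{t-1})`: at a continuation history, it is the (restriction
of the) original conjectures at the corresponding original history. -/
def contConj (E : Economy A B) (φ : ConjFam A B) (m : PreMatching A B) (t : ℕ) :
    ConjFam A B :=
  fun s mbar k => (fun m' => restrictM m' t) '' φ (t + s) (splice m mbar t) k

/-- The conjectures of eq. (2): the agent only rules out continuation matchings that do
not conform with the solution concept `S` from tomorrow onward. -/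
def starConj (S : Economy A B → Set (PreMatching A B)) (E : Economy A B) : ConjFam A B :=
  fun t m k =>
    {m' | m' ∈ MSet E m t k ∧ restrictM m' (t+1) ∈ S (contEconomy E m' (t+1))}

/-- `S` is the solution correspondence `Σ*` recursively generated by the conjectures of
eq. (2): stability for one-period economies, `Φ*`-solutions for longer economies
(empty continuations impose no restriction). -/
def IsStarFamily (P : Pref A B) (S : Economy A B → Set (PreMatching A B)) : Prop :=
  (∀ E : Economy A B, E.T = 0 → S E = Set.univ) ∧
  (∀ E : Economy A B, E.T = 1 → S E = {m | Stable1 P E m}) ∧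
  (∀ E : Economy A B, 2 ≤ E.T → S E = SolSet P E (starConj S E))

/-- The decreasing recursion defining the CVR conjectures at period `t`, history `m`,
relative to the continuation solution correspondence `DS`. -/
def cvrIter (P : Pref A B) (E : Economy A B)
    (DS : Economy A B → Set (PreMatching A B)) (t : ℕ) (m : PreMatching A B) :
    ℕ → Agent A B → Set (PreMatching A B)
  | 0 => fun k => MSet E m t k
  | n+1 => fun k =>
      {mbar | mbar ∈ MSet E m t k ∧
        StableAmongMatched P E m t (cvrIter P E DS t m n) mbar ∧
        restrictM mbar (t+1) ∈ DS (contEconomy E mbar (t+1))}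

/-- The CVR conjectures `φ_{D̂S,t}(m^{t-1},·)`: the limit (intersection) of the
decreasing recursion `cvrIter`. -/
def cvrConj (P : Pref A B) (DS : Economy A B → Set (PreMatching A B))
    (E : Economy A B) : ConjFam A B :=
  fun t m k => ⋂ n, cvrIter P E DS t m n k

/-- `DS` is the CVR-dynamic-stability correspondence `D̂S`: stable matchings for
one-period economies, `Φ_{D̂S}`-solutions for longer economies. -/
def IsCVRFamily (P : Pref A B) (DS : Economy A B → Set (PreMatching A B)) : Prop :=
  (∀ E : Economy A B, E.T = 0 → DS E = Set.univ) ∧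
  (∀ E : Economy A B, E.T = 1 → DS E = {m | Stable1 P E m}) ∧
  (∀ E : Economy A B, 2 ≤ E.T → DS E = SolSet P E (cvrConj P DS E))

/-- The dynamic-stability conjectures of Doval (2022): the period-`t` matching is stable
among those who match relative to individually rational continuation values, and the
continuation is dynamically stable. -/
def dsConj (P : Pref A B) (DSol : Economy A B → Set (PreMatching A B))
    (E : Economy A B) : ConjFam A B :=
  fun t m k =>
    {mbar | mbar ∈ MSet E m t k ∧
      (∀ a ∈ availA E m t, ∀ b, mbar.mA t a = some b → 0 ≤ P.u a b) ∧
      (∀ b ∈ availB E m t, ∀ a, mbar.mB t b = some a → 0 ≤ P.v a b) ∧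
      (∀ a ∈ availA E m t, ∀ b ∈ availB E m t, ∀ b' a',
         mbar.mA t a = some b' → mbar.mB t b = some a' →
         ¬(P.u a b > P.u a b' ∧ P.v a b > P.v a' b)) ∧
      restrictM mbar (t+1) ∈ DSol (contEconomy E mbar (t+1))}

/-- `DSol` is the dynamic-stability correspondence `DS` of Doval (2022). -/
def IsDSFamily (P : Pref A B) (DSol : Economy A B → Set (PreMatching A B)) : Prop :=
  (∀ E : Economy A B, E.T = 0 → DSol E = Set.univ) ∧
  (∀ E : Economy A B, E.T = 1 → DSol E = {m | Stable1 P E m}) ∧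
  (∀ E : Economy A B, 2 ≤ E.T → DSol E = SolSet P E (dsConj P DSol E))

/-- `E_{\k}`: the economy identical to `E` except that agent `k`'s arrival is delayed
by one period (from period `0` to period `1`). -/
def delayEconomy (E : Economy A B) : Agent A B → Economy A B
  | Sum.inl a =>
      { T := E.T
        arrA := fun s => if s = 0 then E.arrA 0 \ {a}
                 else if s = 1 then insert a (E.arrA 1) else E.arrA s
        arrB := E.arrB }
  | Sum.inr b =>
      { T := E.T
        arrA := E.arrA
        arrB := fun s => if s = 0 then E.arrB 0 \ {b}
                 else if s = 1 then insert b (E.arrB 1) else E.arrB s }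

/-- The candidate set `M*(m^{t-1}, C, Scont)`: matchings whose period-`t` matching is
stable in the one-period economy induced by the continuation-value sets `C`, and whose
continuation lies in `Scont` of the induced continuation economy. -/
def candT (P : Pref A B) (Scont : Economy A B → Set (PreMatching A B))
    (E : Economy A B) (t : ℕ) (m : PreMatching A B)
    (C : Agent A B → Set (PreMatching A B)) : Set (PreMatching A B) :=
  {mbar | mbar ∈ MSetH E m t ∧ StableInduced P E m t C mbar ∧
    restrictM mbar (t+1) ∈ Scont (contEconomy E mbar (t+1))}

/-- The increasing recursion `F_n` defining the sophisticated-dynamic-stability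
conjectures at period `t`, history `m`, relative to the correspondence `SDS` on
strictly shorter problems. -/
def sdsF (P : Pref A B) (SDS : Economy A B → Set (PreMatching A B))
    (E : Economy A B) (t : ℕ) (m : PreMatching A B) :
    ℕ → Agent A B → Set (PreMatching A B)
  | 0 => fun k =>
      {mbar | mbar ∈ MSet E m t k ∧
        restrictM mbar t ∈ SDS (delayEconomy (contEconomy E m t) k)}
  | n+1 => fun k => sdsF P SDS E t m n k ∪
      {mbar | mbar ∈ candT P SDS E t m (sdsF P SDS E t m n) ∧ unmatchedAt mbar t k}

/-- The SDS conjectures `φ_{SDS,t}`: the limit (union) of the increasing recursion `F_n`. -/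
def sdsConj (P : Pref A B) (SDS : Economy A B → Set (PreMatching A B))
    (E : Economy A B) : ConjFam A B :=
  fun t m k => ⋃ n, sdsF P SDS E t m n k

/-- `SDS` is the sophisticated-dynamic-stability correspondence. -/
def IsSDSFamily (P : Pref A B) (SDS : Economy A B → Set (PreMatching A B)) : Prop :=
  (∀ E : Economy A B, E.T = 0 → SDS E = Set.univ) ∧
  (∀ E : Economy A B, E.T = 1 → SDS E = {m | Stable1 P E m}) ∧
  (∀ E : Economy A B, 2 ≤ E.T → SDS E = SolSet P E (sdsConj P SDS E))

/-- The rational-expectations conjectures: `k` conjectures exactly the `RE` solutions of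
the continuation economy in which `k`'s arrival is delayed by one period. -/
def reConj (RE : Economy A B → Set (PreMatching A B)) (E : Economy A B) : ConjFam A B :=
  fun t m k =>
    {mbar | mbar ∈ MSet E m t k ∧
      restrictM mbar t ∈ RE (delayEconomy (contEconomy E m t) k)}

/-- `RE` is the rational-expectations solution correspondence. -/
def IsREFamily (P : Pref A B) (RE : Economy A B → Set (PreMatching A B)) : Prop :=
  (∀ E : Economy A B, E.T = 1 → RE E = {m | Stable1 P E m}) ∧
  (∀ E : Economy A B, 2 ≤ E.T → RE E = SolSet P E (reConj RE E))


/-! ### The Example-2 economy.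
Side-`A` agents `a1,…,a4` are `0,…,3 : Fin 4`; side-`B` agents `b1,…,b4` are
`0,…,3 : Fin 4`. Arrivals: `A_1 = {a1,a2}`, `B_1 = {b1,b2}`, `A_2 = {a3,a4}`,
`B_2 = {b3,b4}`. -/

/-- The Example-2 economy. -/
def E2econ : Economy (Fin 4) (Fin 4) where
  T := 2
  arrA := fun s => if s = 0 then {0, 1} else if s = 1 then {2, 3} else ∅
  arrB := fun s => if s = 0 then {0, 1} else if s = 1 then {2, 3} else ∅

/-- `P` realizes the static strict rankings of Example 2 (unlisted partners are
unacceptable), with period-1 agents' discount factors strictly below but close enough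
to `1` that a better static partner is preferred regardless of timing. -/
def Ex2Pref (P : Pref (Fin 4) (Fin 4)) : Prop :=
  P.Valid ∧
  (∀ i : Fin 4, i = 0 ∨ i = 1 → P.dA i < 1 ∧
    ∀ j j' : Fin 4, P.u i j > P.u i j' → P.dA i * P.u i j > P.u i j') ∧
  (∀ j : Fin 4, j = 0 ∨ j = 1 → P.dB j < 1 ∧
    ∀ i i' : Fin 4, P.v i j > P.v i' j → P.dB j * P.v i j > P.v i' j) ∧
  -- a1: b3 ≻ b4 ≻ b1, b2 unacceptable
  (P.u 0 2 > P.u 0 3 ∧ P.u 0 3 > P.u 0 0 ∧ P.u 0 0 > 0 ∧ P.u 0 1 < 0) ∧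
  -- a2: b4 ≻ b2 ≻ b3, b1 unacceptable
  (P.u 1 3 > P.u 1 1 ∧ P.u 1 1 > P.u 1 2 ∧ P.u 1 2 > 0 ∧ P.u 1 0 < 0) ∧
  -- a3: b1 ≻ b4 ≻ b2, b3 unacceptable
  (P.u 2 0 > P.u 2 3 ∧ P.u 2 3 > P.u 2 1 ∧ P.u 2 1 > 0 ∧ P.u 2 2 < 0) ∧
  -- a4: b1 ≻ b4 ≻ b2 ≻ b3
  (P.u 3 0 > P.u 3 3 ∧ P.u 3 3 > P.u 3 1 ∧ P.u 3 1 > P.u 3 2 ∧ P.u 3 2 > 0) ∧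
  -- b1: a3 ≻ a4 ≻ a1, a2 unacceptable
  (P.v 2 0 > P.v 3 0 ∧ P.v 3 0 > P.v 0 0 ∧ P.v 0 0 > 0 ∧ P.v 1 0 < 0) ∧
  -- b2: a2 ≻ a3 ≻ a4, a1 unacceptable
  (P.v 1 1 > P.v 2 1 ∧ P.v 2 1 > P.v 3 1 ∧ P.v 3 1 > 0 ∧ P.v 0 1 < 0) ∧
  -- b3: a1 ≻ a2 ≻ a4, a3 unacceptable
  (P.v 0 2 > P.v 1 2 ∧ P.v 1 2 > P.v 3 2 ∧ P.v 3 2 > 0 ∧ P.v 2 2 < 0) ∧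
  -- b4: a1 ≻ a3 ≻ a2 ≻ a4
  (P.v 0 3 > P.v 2 3 ∧ P.v 2 3 > P.v 1 3 ∧ P.v 1 3 > P.v 3 3 ∧ P.v 3 3 > 0)

/-- The matching `m^L`: `a2–b2` in period 1; `a1–b3`, `a3–b1`, `a4–b4` in period 2. -/
def mL : PreMatching (Fin 4) (Fin 4) where
  mA := fun t a => if t = 0 then (if a = 1 then some 1 else none)
    else (if a = 0 then some 2 else if a = 1 then some 1 else
          if a = 2 then some 0 else some 3)
  mB := fun t b => if t = 0 then (if b = 1 then some 1 else none)
    else (if b = 0 then some 2 else if b = 1 then some 1 else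
          if b = 2 then some 0 else some 3)

/-! ### Payoffs and availability in short economies -/

lemma Upay_of_matched_now {α β : Type} (P : Pref α β) (E : Economy α β) (m : PreMatching α β) (t : ℕ) (a : α)
    (h : m.mA (E.T - 1) a ≠ none → m.mA t a ≠ none) :
    Upay P E m t a = indU P (fun _ => 0) a (m.mA (E.T - 1) a) := by
  unfold Upay
  cases hb : m.mA (E.T - 1) a with
  | none => rfl
  | some b =>
    have ht : matchTimeA E m t a ≤ t :=
      (min_le_left _ _).trans (Nat.sInf_le ⟨le_rfl, h (by simp [hb])⟩)
    simp [indU, Nat.sub_eq_zero_of_le ht]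

lemma Vpay_of_matched_now {α β : Type} (P : Pref α β) (E : Economy α β) (m : PreMatching α β) (t : ℕ) (b : β)
    (h : m.mB (E.T - 1) b ≠ none → m.mB t b ≠ none) :
    Vpay P E m t b = indV P (fun _ => 0) b (m.mB (E.T - 1) b) := by
  unfold Vpay
  cases hb : m.mB (E.T - 1) b with
  | none => rfl
  | some a =>
    have ht : matchTimeB E m t b ≤ t :=
      (min_le_left _ _).trans (Nat.sInf_le ⟨le_rfl, h (by simp [hb])⟩)
    simp [indV, Nat.sub_eq_zero_of_le ht]

lemma Upay_of_matched_next {α β : Type} (P : Pref α β) (E : Economy α β) (hE : E.T = 2)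
    (m : PreMatching α β) {a : α} {b : β} (h0 : m.mA 0 a = none) (h1 : m.mA 1 a = some b) :
    Upay P E m 0 a = P.dA a * P.u a b := by
  have ht : sInf {s | 0 ≤ s ∧ m.mA s a ≠ none} = 1 := by
    refine le_antisymm (Nat.sInf_le ⟨Nat.zero_le _, by simp [h1]⟩) ?_
    refine le_csInf ⟨1, Nat.zero_le _, by simp [h1]⟩ ?_
    rintro s ⟨-, hs⟩
    by_contra! hs'
    obtain rfl : s = 0 := by omega
    exact hs h0
  simp only [Upay, matchTimeA, hE, h1, ht]
  simp

lemma Vpay_of_matched_next {α β : Type} (P : Pref α β) (E : Economy α β) (hE : E.T = 2)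
    (m : PreMatching α β) {b : β} {a : α} (h0 : m.mB 0 b = none) (h1 : m.mB 1 b = some a) :
    Vpay P E m 0 b = P.dB b * P.v a b := by
  have ht : sInf {s | 0 ≤ s ∧ m.mB s b ≠ none} = 1 := by
    refine le_antisymm (Nat.sInf_le ⟨Nat.zero_le _, by simp [h1]⟩) ?_
    refine le_csInf ⟨1, Nat.zero_le _, by simp [h1]⟩ ?_
    rintro s ⟨-, hs⟩
    by_contra! hs'
    obtain rfl : s = 0 := by omega
    exact hs h0
  simp only [Vpay, matchTimeB, hE, h1, ht]
  simp

lemma mem_availA_E2econ_zero (m : PreMatching (Fin 4) (Fin 4)) (a : Fin 4) :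
    a ∈ availA E2econ m 0 ↔ a = 0 ∨ a = 1 := by
  simp [availA, arrAUpTo, E2econ]

lemma mem_availB_E2econ_zero (m : PreMatching (Fin 4) (Fin 4)) (b : Fin 4) :
    b ∈ availB E2econ m 0 ↔ b = 0 ∨ b = 1 := by
  simp [availB, arrBUpTo, E2econ]

lemma arrAUpTo_E2econ_one : arrAUpTo E2econ 1 = Finset.univ := by
  ext a; fin_cases a <;> simp [arrAUpTo, E2econ, Finset.range_add_one]

lemma arrBUpTo_E2econ_one : arrBUpTo E2econ 1 = Finset.univ := by
  ext a; fin_cases a <;> simp [arrBUpTo, E2econ, Finset.range_add_one]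

lemma mem_availA_E2econ_one (m : PreMatching (Fin 4) (Fin 4)) (a : Fin 4) :
    a ∈ availA E2econ m 1 ↔ m.mA 0 a = none := by
  simp [availA, arrAUpTo_E2econ_one]

lemma mem_availB_E2econ_one (m : PreMatching (Fin 4) (Fin 4)) (b : Fin 4) :
    b ∈ availB E2econ m 1 ↔ m.mB 0 b = none := by
  simp [availB, arrBUpTo_E2econ_one]

/-- No pair unmatched in the first period blocks the second-period matching. -/
def NoLateBlock {α β : Type} (P : Pref α β) (m : PreMatching α β) : Prop :=
  ∀ a b, m.mA 0 a = none → m.mB 0 b = none →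
    ¬(P.u a b > indU P (fun _ => 0) a (m.mA 1 a) ∧ P.v a b > indV P (fun _ => 0) b (m.mB 1 b))

/-- Second-period partners are acceptable. -/
def LateIR {α β : Type} (P : Pref α β) (m : PreMatching α β) : Prop :=
  (∀ a b, m.mA 0 a = none → m.mA 1 a = some b → 0 ≤ P.u a b) ∧
  (∀ b a, m.mB 0 b = none → m.mB 1 b = some a → 0 ≤ P.v a b)

lemma isMatching_E2econ_iff (m : PreMatching (Fin 4) (Fin 4)) :
    IsMatching E2econ m ↔
      (∀ a b, m.mA 0 a = some b ↔ m.mB 0 b = some a) ∧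
      (∀ a b, m.mA 1 a = some b ↔ m.mB 1 b = some a) ∧
      (∀ a b, m.mA 0 a = some b → (a = 0 ∨ a = 1) ∧ (b = 0 ∨ b = 1)) ∧
      (∀ a b, m.mA 0 a = some b → m.mA 1 a = some b) := by
  have hA : ∀ a, a ∈ arrAUpTo E2econ 0 ↔ a = 0 ∨ a = 1 := by simp [arrAUpTo, E2econ]
  have hB : ∀ a, a ∈ arrBUpTo E2econ 0 ↔ a = 0 ∨ a = 1 := by simp [arrBUpTo, E2econ]
  constructor
  · rintro ⟨h1, h2, h3, h4, -⟩
    refine ⟨fun a b => h1 0 a b (by simp [E2econ]), fun a b => h1 1 a b (by simp [E2econ]),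
      fun a b h => ⟨(hA a).1 (h2 0 a (by simp [E2econ]) (by simp [h])),
        (hB b).1 (h3 0 a b (by simp [E2econ]) h)⟩, fun a b h => ?_⟩
    rw [h4 0 1 a (by simp) (by simp [E2econ]) (by simp [h]), h]
  · rintro ⟨h1, h2, h3, h4⟩
    have hT : E2econ.T = 2 := rfl
    refine ⟨?_, ?_, ?_, ?_, ?_⟩
    · intro t a b ht
      rw [hT] at ht
      interval_cases t
      exacts [h1 a b, h2 a b]
    · intro t a ht h
      rw [hT] at ht
      obtain ⟨b, hb⟩ := Option.ne_none_iff_exists'.1 h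
      interval_cases t
      exacts [(hA a).2 (h3 a b hb).1, by simp [arrAUpTo_E2econ_one]]
    · intro t a b ht h
      rw [hT] at ht
      interval_cases t
      exacts [(hB b).2 (h3 a b h).2, by simp [arrBUpTo_E2econ_one]]
    · intro t s a hts hs h
      rw [hT] at hs
      obtain ⟨b, hb⟩ := Option.ne_none_iff_exists'.1 h
      interval_cases s <;> interval_cases t
      exacts [rfl, by rw [hb, h4 a b hb], rfl]
    · intro t s b hts hs h
      rw [hT] at hs
      obtain ⟨a, ha⟩ := Option.ne_none_iff_exists'.1 h
      interval_cases s <;> interval_cases t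
      exacts [rfl, by rw [ha, (h2 a b).1 (h4 a b ((h1 a b).2 ha))], rfl]

lemma stable1_continuation_iff (P : Pref (Fin 4) (Fin 4)) (m : PreMatching (Fin 4) (Fin 4))
    (hm : IsMatching E2econ m) :
    Stable1 P (contEconomy E2econ m 1) (restrictM m 1) ↔ LateIR P m ∧ NoLateBlock P m := by
  obtain ⟨h1, h2, h3, h4⟩ := (isMatching_E2econ_iff m).1 hm
  have hT : (contEconomy E2econ m 1).T = 1 := rfl
  have hrA : ∀ a, (restrictM m 1).mA 0 a = if m.mA 0 a = none then m.mA 1 a else none := by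
    intro a; simp [restrictM]
  have hrB : ∀ a, (restrictM m 1).mB 0 a = if m.mB 0 a = none then m.mB 1 a else none := by
    intro a; simp [restrictM]
  have hA : ∀ a, a ∈ (contEconomy E2econ m 1).arrA 0 ↔ m.mA 0 a = none := by
    intro a; rw [← mem_availA_E2econ_one]; rfl
  have hB : ∀ a, a ∈ (contEconomy E2econ m 1).arrB 0 ↔ m.mB 0 a = none := by
    intro a; rw [← mem_availB_E2econ_one]; rfl
  have hA' : ∀ a, m.mA 0 a = none → a ∈ arrAUpTo (contEconomy E2econ m 1) 0 := by
    intro a h; simpa [arrAUpTo] using (hA a).2 h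
  have hB' : ∀ a, m.mB 0 a = none → a ∈ arrBUpTo (contEconomy E2econ m 1) 0 := by
    intro a h; simpa [arrBUpTo] using (hB a).2 h
  have hU : ∀ a, m.mA 0 a = none → Upay P (contEconomy E2econ m 1) (restrictM m 1) 0 a =
      indU P (fun _ => 0) a (m.mA 1 a) := by
    intro a h
    rw [Upay_of_matched_now _ _ _ _ _ (by simp [hT]), hT, hrA, if_pos h]
  have hV : ∀ a, m.mB 0 a = none → Vpay P (contEconomy E2econ m 1) (restrictM m 1) 0 a =
      indV P (fun _ => 0) a (m.mB 1 a) := by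
    intro a h
    rw [Vpay_of_matched_now _ _ _ _ _ (by simp [hT]), hT, hrB, if_pos h]
  constructor
  · rintro ⟨-, i1, i2, i3⟩
    simp only [hT, Nat.sub_self, hrA, hrB] at i1 i2
    refine ⟨⟨fun a b h h' => i1 a b (by rw [if_pos h, h']),
      fun b a h h' => i2 b a (by rw [if_pos h, h'])⟩, fun a b ha hb => ?_⟩
    rw [← hU a ha, ← hV b hb]
    exact i3 a ((hA a).2 ha) b ((hB b).2 hb)
  · rintro ⟨⟨i1, i2⟩, i3⟩
    have key : ∀ a b, m.mA 1 a = some b → (m.mA 0 a = none ↔ m.mB 0 b = none) := by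
      intro a b hab
      constructor
      · intro h
        by_contra h'
        obtain ⟨c, hc⟩ := Option.ne_none_iff_exists'.1 h'
        have := (h2 _ _).1 (h4 c b ((h1 c b).2 hc))
        rw [(h2 a b).1 hab] at this
        cases this
        simp [(h1 a b).2 hc] at h
      · intro h
        by_contra h'
        obtain ⟨c, hc⟩ := Option.ne_none_iff_exists'.1 h'
        have := h4 a c hc
        rw [hab] at this
        cases this
        simp [(h1 a b).1 hc] at h
    have inv : ∀ a b, (restrictM m 1).mA 0 a = some b ↔ (restrictM m 1).mB 0 b = some a := by
      intro a b
      rw [hrA, hrB]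
      split_ifs with h h' h'
      · exact h2 a b
      · simpa using fun hab => h' ((key a b hab).1 h)
      · simpa using fun hab => h ((key a b ((h2 a b).2 hab)).2 h')
      · simp
    refine ⟨⟨?_, ?_, ?_, ?_, ?_⟩, ?_, ?_, ?_⟩
    · intro t a b ht
      obtain rfl : t = 0 := by omega
      exact inv a b
    · intro t a ht h
      obtain rfl : t = 0 := by omega
      rw [hrA] at h
      exact hA' a (by by_contra h'; simp [h'] at h)
    · intro t a b ht h
      obtain rfl : t = 0 := by omega
      rw [inv, hrB] at h
      exact hB' b (by by_contra h'; simp [h'] at h)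
    · intro t s a hts hs _
      obtain rfl : s = t := by omega
      rfl
    · intro t s a hts hs _
      obtain rfl : s = t := by omega
      rfl
    · intro a b h
      rw [hT, hrA] at h
      split_ifs at h with h'
      exact i1 a b h' h
    · intro b a h
      rw [hT, hrB] at h
      split_ifs at h with h'
      exact i2 b a h' h
    · intro a ha b hb
      rw [hU a ((hA a).1 ha), hV b ((hB b).1 hb)]
      exact i3 a b ((hA a).1 ha) ((hB b).1 hb)

lemma NoLateBlock.match_of_top {P : Pref (Fin 4) (Fin 4)} {m : PreMatching (Fin 4) (Fin 4)}
    (hs : NoLateBlock P m) (hm : IsMatching E2econ m) {a b : Fin 4}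
    (ha : m.mA 0 a = none) (hb : m.mB 0 b = none) (hu : 0 < P.u a b) (hv : 0 < P.v a b)
    (hu' : ∀ j, j ≠ b → m.mA 1 a = some j → P.u a j < P.u a b)
    (hv' : ∀ i, i ≠ a → m.mA 1 i = some b → P.v i b < P.v a b) : m.mA 1 a = some b := by
  obtain ⟨-, h2, -, -⟩ := (isMatching_E2econ_iff m).1 hm
  by_contra hne
  refine hs a b ha hb ⟨?_, ?_⟩
  · cases h : m.mA 1 a with
    | none => exact hu
    | some j => exact hu' j (fun hj => hne (hj ▸ h)) h
  · cases h : m.mB 1 b with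
    | none => exact hv
    | some i => exact hv' i (fun hi => hne ((h2 a b).2 (hi ▸ h))) ((h2 i b).2 h)

/-! ### Auxiliary matchings -/

/-- The two-period matching with first- and second-period pairings `f₀, f₁` of side `A` and
`g₀, g₁` of side `B`. -/
def twoPeriod (f₀ f₁ g₀ g₁ : Fin 4 → Option (Fin 4)) : PreMatching (Fin 4) (Fin 4) where
  mA := fun t => if t = 0 then f₀ else f₁
  mB := fun t => if t = 0 then g₀ else g₁

/-- `a1–b1` in period 1; `a2–b2`, `a3–b4`, `a4–b3` in period 2. -/
def mPunish : PreMatching (Fin 4) (Fin 4) :=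
  twoPeriod ![some 0, none, none, none] ![some 0, some 1, some 3, some 2]
    ![some 0, none, none, none] ![some 0, some 1, some 3, some 2]

/-- `a2–b2` in period 1 and nobody else ever matched. -/
def mIdle : PreMatching (Fin 4) (Fin 4) :=
  twoPeriod ![none, some 1, none, none] ![none, some 1, none, none]
    ![none, some 1, none, none] ![none, some 1, none, none]

/-- Nobody matched in period 1; `a1–b3`, `a2–b4`, `a3–b1`, `a4–b2` in period 2. -/
def mWait : PreMatching (Fin 4) (Fin 4) :=
  twoPeriod ![none, none, none, none] ![some 2, some 3, some 0, some 1]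
    ![none, none, none, none] ![some 2, some 3, some 0, some 1]

lemma isMatching_mL : IsMatching E2econ mL := by
  rw [isMatching_E2econ_iff]; decide

lemma isMatching_mPunish : IsMatching E2econ mPunish := by
  rw [isMatching_E2econ_iff]; decide

lemma isMatching_mIdle : IsMatching E2econ mIdle := by
  rw [isMatching_E2econ_iff]; decide

lemma isMatching_mWait : IsMatching E2econ mWait := by
  rw [isMatching_E2econ_iff]; decide

lemma late_mL {P : Pref (Fin 4) (Fin 4)} (hP : Ex2Pref P) :
    LateIR P mL ∧ NoLateBlock P mL := by
  obtain ⟨-, -, -, h1, h2, h3, h4, k1, k2, k3, k4⟩ := hP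
  refine ⟨⟨fun a b => ?_, fun b a => ?_⟩, fun a b => ?_⟩ <;> fin_cases a <;> fin_cases b <;>
    simp [mL, indU, indV] <;> intros <;> linarith

lemma late_mPunish {P : Pref (Fin 4) (Fin 4)} (hP : Ex2Pref P) :
    LateIR P mPunish ∧ NoLateBlock P mPunish := by
  obtain ⟨-, -, -, h1, h2, h3, h4, k1, k2, k3, k4⟩ := hP
  refine ⟨⟨fun a b => ?_, fun b a => ?_⟩, fun a b => ?_⟩ <;> fin_cases a <;> fin_cases b <;>
    simp [mPunish, twoPeriod, indU, indV] <;> intros <;> linarith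

lemma late_mWait {P : Pref (Fin 4) (Fin 4)} (hP : Ex2Pref P) :
    LateIR P mWait ∧ NoLateBlock P mWait := by
  obtain ⟨-, -, -, h1, h2, h3, h4, k1, k2, k3, k4⟩ := hP
  refine ⟨⟨fun a b => ?_, fun b a => ?_⟩, fun a b => ?_⟩ <;> fin_cases a <;> fin_cases b <;>
    simp [mWait, twoPeriod, indU, indV] <;> intros <;> linarith

/-! ### Payoffs under `mL` -/

lemma Upay_late (P : Pref (Fin 4) (Fin 4)) (m : PreMatching (Fin 4) (Fin 4)) (a : Fin 4) :
    Upay P E2econ m 1 a = indU P (fun _ => 0) a (m.mA 1 a) :=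
  Upay_of_matched_now P E2econ m 1 a id

lemma Vpay_late (P : Pref (Fin 4) (Fin 4)) (m : PreMatching (Fin 4) (Fin 4)) (b : Fin 4) :
    Vpay P E2econ m 1 b = indV P (fun _ => 0) b (m.mB 1 b) :=
  Vpay_of_matched_now P E2econ m 1 b id

lemma Upay_mL_a1 (P : Pref (Fin 4) (Fin 4)) : Upay P E2econ mL 0 0 = P.dA 0 * P.u 0 2 :=
  Upay_of_matched_next P E2econ rfl mL rfl rfl

lemma Upay_mL_a2 (P : Pref (Fin 4) (Fin 4)) : Upay P E2econ mL 0 1 = P.u 1 1 :=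
  Upay_of_matched_now P E2econ mL 0 1 (by simp [mL])

lemma Vpay_mL_b1 (P : Pref (Fin 4) (Fin 4)) : Vpay P E2econ mL 0 0 = P.dB 0 * P.v 2 0 :=
  Vpay_of_matched_next P E2econ rfl mL rfl rfl

lemma Vpay_mL_b2 (P : Pref (Fin 4) (Fin 4)) : Vpay P E2econ mL 0 1 = P.v 1 1 :=
  Vpay_of_matched_now P E2econ mL 0 1 (by simp [mL])

/-! ### Dynamic stability of `mL` -/

lemma agreeUpTo_zero {α β : Type} (m m' : PreMatching α β) : agreeUpTo m m' 0 :=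
  fun s hs => absurd hs (Nat.not_lt_zero s)

lemma mem_MSet_zero {α β : Type} [DecidableEq α] [DecidableEq β] {E : Economy α β}
    {m m' : PreMatching α β} {k : Agent α β} :
    m' ∈ MSet E m 0 k ↔ IsMatching E m' ∧ unmatchedAt m' 0 k := by
  rcases k with a | b <;> simp [MSet, agreeUpTo_zero, unmatchedThrough, unmatchedAt]

lemma mL_mem_dsConj {P : Pref (Fin 4) (Fin 4)} (hP : Ex2Pref P)
    {DSol : Economy (Fin 4) (Fin 4) → Set (PreMatching (Fin 4) (Fin 4))}
    (hDSol : IsDSFamily P DSol) (m : PreMatching (Fin 4) (Fin 4)) {k : Agent (Fin 4) (Fin 4)}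
    (hk : unmatchedAt mL 0 k) : mL ∈ dsConj P DSol E2econ 0 m k := by
  have hlate := (stable1_continuation_iff P mL isMatching_mL).2 (late_mL hP)
  obtain ⟨-, -, -, h1, h2, h3, h4, k1, k2, k3, k4⟩ := hP
  refine ⟨mem_MSet_zero.2 ⟨isMatching_mL, hk⟩, fun a _ b => ?_, fun b _ a => ?_,
    fun a _ b _ b' a' => ?_, by rw [hDSol.2.1 _ rfl]; exact hlate⟩
  · fin_cases a <;> fin_cases b <;> simp [mL]; linarith
  · fin_cases a <;> fin_cases b <;> simp [mL]; linarith
  · fin_cases a <;> fin_cases b <;> simp [mL]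
    rintro rfl rfl h
    exact absurd h (lt_irrefl _)

lemma mPunish_mem_dsConj {P : Pref (Fin 4) (Fin 4)} (hP : Ex2Pref P)
    {DSol : Economy (Fin 4) (Fin 4) → Set (PreMatching (Fin 4) (Fin 4))}
    (hDSol : IsDSFamily P DSol) (m : PreMatching (Fin 4) (Fin 4)) {k : Agent (Fin 4) (Fin 4)}
    (hk : unmatchedAt mPunish 0 k) : mPunish ∈ dsConj P DSol E2econ 0 m k := by
  have hlate := (stable1_continuation_iff P mPunish isMatching_mPunish).2 (late_mPunish hP)
  obtain ⟨-, -, -, h1, h2, h3, h4, k1, k2, k3, k4⟩ := hP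
  refine ⟨mem_MSet_zero.2 ⟨isMatching_mPunish, hk⟩, fun a _ b => ?_, fun b _ a => ?_,
    fun a _ b _ b' a' => ?_, by rw [hDSol.2.1 _ rfl]; exact hlate⟩
  · fin_cases a <;> fin_cases b <;> simp [mPunish, twoPeriod]; linarith
  · fin_cases a <;> fin_cases b <;> simp [mPunish, twoPeriod]; linarith
  · fin_cases a <;> fin_cases b <;> simp [mPunish, twoPeriod]
    rintro rfl rfl h
    exact absurd h (lt_irrefl _)

lemma mIdle_mem_dsConj {P : Pref (Fin 4) (Fin 4)}
    {DSol : Economy (Fin 4) (Fin 4) → Set (PreMatching (Fin 4) (Fin 4))}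
    (hDSol : IsDSFamily P DSol) {k : Agent (Fin 4) (Fin 4)} (hk : unmatchedAt mL 0 k) :
    mIdle ∈ dsConj P DSol E2econ 1 mL k := by
  have hA : ∀ a b, mL.mA 0 a = none → mIdle.mA 1 a ≠ some b := by decide
  have hB : ∀ a b, mL.mB 0 a = none → mIdle.mB 1 a ≠ some b := by decide
  have hkA : ∀ a, mL.mA 0 a = none → ∀ s, s ≤ 1 → mIdle.mA s a = none := by decide
  have hkB : ∀ b, mL.mB 0 b = none → ∀ s, s ≤ 1 → mIdle.mB s b = none := by decide
  refine ⟨⟨isMatching_mIdle, ?_, ?_⟩, ?_, ?_, ?_, ?_⟩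
  · intro s hs
    obtain rfl : s = 0 := by omega
    decide
  · rcases k with a | b
    exacts [hkA a hk, hkB b hk]
  · intro a ha b h
    exact absurd h (hA a b ((mem_availA_E2econ_one _ _).1 ha))
  · intro b hb a h
    exact absurd h (hB b a ((mem_availB_E2econ_one _ _).1 hb))
  · intro a ha b _ b' _ h
    exact absurd h (hA a b' ((mem_availA_E2econ_one _ _).1 ha))
  · rw [hDSol.1 _ rfl]
    trivial

theorem mL_mem_DS {P : Pref (Fin 4) (Fin 4)} (hP : Ex2Pref P)
    {DSol : Economy (Fin 4) (Fin 4) → Set (PreMatching (Fin 4) (Fin 4))}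
    (hDSol : IsDSFamily P DSol) : mL ∈ DSol E2econ := by
  rw [hDSol.2.2 E2econ le_rfl]
  refine ⟨isMatching_mL, fun t ht => ?_⟩
  replace ht : t < 2 := ht
  have hlate := late_mL hP
  have hP' := hP
  obtain ⟨hv, hA, hB, h1, h2, h3, h4, k1, k2, k3, k4⟩ := hP'
  interval_cases t
  · simp only [mem_availA_E2econ_zero, mem_availB_E2econ_zero]
    refine ⟨?_, ?_, ?_⟩
    · rintro a (rfl | rfl)
      · exact ⟨mL, mL_mem_dsConj hP hDSol _ rfl, le_rfl⟩
      · refine ⟨mPunish, mPunish_mem_dsConj hP hDSol _ rfl, ?_⟩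
        rw [Upay_of_matched_next P E2econ rfl mPunish (b := 1) rfl rfl, Upay_mL_a2]
        exact mul_le_of_le_one_left (by linarith) (hv.1 1).2
    · rintro b (rfl | rfl)
      · exact ⟨mL, mL_mem_dsConj hP hDSol _ rfl, le_rfl⟩
      · refine ⟨mPunish, mPunish_mem_dsConj hP hDSol _ rfl, ?_⟩
        rw [Vpay_of_matched_next P E2econ rfl mPunish (a := 1) rfl rfl, Vpay_mL_b2]
        exact mul_le_of_le_one_left (by linarith) (hv.2 1).2
    · have h02 := (hA 0 (by simp)).2 2 0 (by linarith)
      rintro a (rfl | rfl) b (rfl | rfl) ⟨hu, hv'⟩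
      · rw [Upay_mL_a1] at hu
        linarith
      · rw [Upay_mL_a1] at hu
        linarith
      · rw [Upay_mL_a2] at hu
        linarith
      · rw [Upay_mL_a2] at hu
        exact lt_irrefl _ hu
  · simp only [mem_availA_E2econ_one, mem_availB_E2econ_one, Upay_late, Vpay_late]
    refine ⟨fun a ha => ⟨mIdle, mIdle_mem_dsConj hDSol ha, ?_⟩,
      fun b hb => ⟨mIdle, mIdle_mem_dsConj hDSol hb, ?_⟩, fun a ha b hb => hlate.2 a b ha hb⟩
    · fin_cases a <;> simp [mL, mIdle, twoPeriod, indU] <;> linarith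
    · fin_cases b <;> simp [mL, mIdle, twoPeriod, indV] <;> linarith

/-! ### Failure of CVR-dynamic stability of `mL` -/

lemma mem_cvrIter_succ_zero {P : Pref (Fin 4) (Fin 4)}
    {S : Economy (Fin 4) (Fin 4) → Set (PreMatching (Fin 4) (Fin 4))} (hS : IsCVRFamily P S)
    {m mbar : PreMatching (Fin 4) (Fin 4)} {n : ℕ} {k : Agent (Fin 4) (Fin 4)} :
    mbar ∈ cvrIter P E2econ S 0 m (n + 1) k ↔
      (IsMatching E2econ mbar ∧ unmatchedAt mbar 0 k) ∧
      StableAmongMatched P E2econ m 0 (cvrIter P E2econ S 0 m n) mbar ∧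
      LateIR P mbar ∧ NoLateBlock P mbar := by
  change (_ ∈ MSet _ _ _ _ ∧ _ ∧ restrictM mbar 1 ∈ S (contEconomy E2econ mbar 1)) ↔ _
  rw [hS.2.1 _ rfl, mem_MSet_zero]
  refine and_congr_right fun h => and_congr_right fun _ => ?_
  exact stable1_continuation_iff P mbar h.1

/-- In any stable continuation in which `a1` is still available, `a1` matches with `b3`. -/
lemma a1_matches_b3 {P : Pref (Fin 4) (Fin 4)} (hP : Ex2Pref P)
    {m : PreMatching (Fin 4) (Fin 4)} (hm : IsMatching E2econ m) (hs : NoLateBlock P m)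
    (h0 : m.mA 0 0 = none) : m.mA 1 0 = some 2 := by
  obtain ⟨-, -, -, h1, h2, h3, h4, k1, k2, k3, k4⟩ := hP
  obtain ⟨i1, -, i3, -⟩ := (isMatching_E2econ_iff m).1 hm
  have hb : m.mB 0 2 = none := by
    by_contra h
    obtain ⟨c, hc⟩ := Option.ne_none_iff_exists'.1 h
    simpa using (i3 c 2 ((i1 c 2).2 hc)).2
  refine hs.match_of_top hm h0 hb (by linarith) (by linarith) ?_ ?_
  · intro j hj _
    fin_cases j <;> simp at hj ⊢ <;> linarith
  · intro i hi _
    fin_cases i <;> simp at hi ⊢ <;> linarith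

/-- If nobody matches in the first period, `a2` matches with `b4` in any stable continuation. -/
lemma a2_matches_b4 {P : Pref (Fin 4) (Fin 4)} (hP : Ex2Pref P)
    {m : PreMatching (Fin 4) (Fin 4)} (hm : IsMatching E2econ m) (hs : NoLateBlock P m)
    (hA : ∀ a, m.mA 0 a = none) : m.mA 1 1 = some 3 := by
  have h02 := a1_matches_b3 hP hm hs (hA 0)
  obtain ⟨-, -, -, h1, h2, h3, h4, k1, k2, k3, k4⟩ := hP
  obtain ⟨i1, -, -, -⟩ := (isMatching_E2econ_iff m).1 hm
  have hB : ∀ b, m.mB 0 b = none := by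
    intro b
    by_contra h
    obtain ⟨c, hc⟩ := Option.ne_none_iff_exists'.1 h
    simpa [hA c] using (i1 c b).2 hc
  have h20 : m.mA 1 2 = some 0 := by
    refine hs.match_of_top hm (hA 2) (hB 0) (by linarith) (by linarith) ?_ ?_
    · intro j hj _
      fin_cases j <;> simp at hj ⊢ <;> linarith
    · intro i hi _
      fin_cases i <;> simp at hi ⊢ <;> linarith
  refine hs.match_of_top hm (hA 1) (hB 3) (by linarith) (by linarith) ?_ ?_
  · intro j hj _
    fin_cases j <;> simp at hj ⊢ <;> linarith
  · intro i hi h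
    fin_cases i <;> simp [h02, h20] at hi h ⊢; linarith

theorem mL_not_mem_CVR {P : Pref (Fin 4) (Fin 4)} (hP : Ex2Pref P)
    {S : Economy (Fin 4) (Fin 4) → Set (PreMatching (Fin 4) (Fin 4))}
    (hS : IsCVRFamily P S) : mL ∉ S E2econ := by
  rw [hS.2.2 E2econ le_rfl]
  rintro ⟨-, h⟩
  obtain ⟨m, hm, hle⟩ := (h 0 (by simp [E2econ])).1 1 (by simp [mem_availA_E2econ_zero])
  have hm2 := Set.mem_iInter.1 hm 2
  rw [mem_cvrIter_succ_zero hS] at hm2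
  obtain ⟨⟨hmat, hun⟩, hst, -, hnb⟩ := hm2
  have hun : m.mA 0 1 = none := hun
  have hP' := hP
  obtain ⟨-, hA, -, h1, h2, -, -, -⟩ := hP'
  have hwait : mWait ∈ cvrIter P E2econ S 0 mL 1 (Sum.inl 0) := by
    rw [mem_cvrIter_succ_zero hS]
    have hA0 : ∀ a b, mWait.mA 0 a ≠ some b := by decide
    have hB0 : ∀ a b, mWait.mB 0 a ≠ some b := by decide
    exact ⟨⟨isMatching_mWait, rfl⟩, ⟨fun a _ b h => absurd h (hA0 a b),
      fun b _ a h => absurd h (hB0 b a), fun a _ _ _ b' _ h => absurd h (hA0 a b')⟩,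
      late_mWait hP⟩
  have hw : P.dA 0 * P.u 0 2 ≤ wA P E2econ 0 (cvrIter P E2econ S 0 mL 1) 0 := by
    refine le_csInf ⟨_, mWait, hwait, rfl⟩ ?_
    rintro _ ⟨m', hm', rfl⟩
    rw [mem_cvrIter_succ_zero hS] at hm'
    obtain ⟨⟨hm1, hm0⟩, -, -, hnb'⟩ := hm'
    exact (Upay_of_matched_next P E2econ rfl m' hm0 (a1_matches_b3 hP hm1 hnb' hm0)).ge
  obtain ⟨-, -, i3, -⟩ := (isMatching_E2econ_iff m).1 hmat
  have h0 : m.mA 0 0 = none := by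
    by_contra h'
    obtain ⟨b, hb⟩ := Option.ne_none_iff_exists'.1 h'
    have hu := hst.1 0 (by simp [mem_availA_E2econ_zero]) b hb
    have h02 := (hA 0 (by simp)).2 2 0 (by linarith)
    rcases (i3 0 b hb).2 with rfl | rfl <;> linarith
  have hnone : ∀ a, m.mA 0 a = none := by
    intro a
    by_contra h'
    obtain ⟨b, hb⟩ := Option.ne_none_iff_exists'.1 h'
    rcases (i3 a b hb).1 with rfl | rfl
    exacts [h' h0, h' hun]
  rw [Upay_of_matched_next P E2econ rfl m hun (a2_matches_b4 hP hmat hnb hnone),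
    Upay_mL_a2] at hle
  have := (hA 1 (by simp)).2 3 1 (by linarith)
  linarith

/-- in the Example-2 economy, `m^L` is dynamically stable but not
CVR-dynamically stable. -/
theorem statement17 (P : Pref (Fin 4) (Fin 4)) (hP : Ex2Pref P)
    (DSol DShat : Economy (Fin 4) (Fin 4) → Set (PreMatching (Fin 4) (Fin 4)))
    (hDSol : IsDSFamily P DSol) (hDShat : IsCVRFamily P DShat) :
    mL ∈ DSol E2econ ∧ mL ∉ DShat E2econ := by
  exact ⟨mL_mem_DS hP hDSol, mL_not_mem_CVR hP hDShat⟩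

end

end DynMatch
end

section
/- In the Example-2 economy, the matching m^R in which no one matches in period 1 and a1–b3, a2–b4, a3–b1, a4–b2 match in period 2 is CVR-dynamically stable (m^R ∈ D̂S_2), and hence also dynamically stable. -/
/-!
A framework for two-sided, one-to-one, irreversible dynamic matching markets
with conjectures, following Doval's "A framework for (dynamic) stability".

Periods are indexed `0, …, T-1` (the paper's periods `1, …, T`).
-/

namespace DynMatch

open Classical

noncomputable section

variable {A B : Type} [DecidableEq A] [DecidableEq B]

/-- The matching `m^R`: no one matches in period 1; `a1–b3`, `a2–b4`, `a3–b1`, `a4–b2`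
in period 2. -/
def mR : PreMatching (Fin 4) (Fin 4) where
  mA := fun t a => if t = 0 then none
    else (if a = 0 then some 2 else if a = 1 then some 3 else
          if a = 2 then some 0 else some 1)
  mB := fun t b => if t = 0 then none
    else (if b = 0 then some 2 else if b = 1 then some 3 else
          if b = 2 then some 0 else some 1)

/-- A matching that leaves everyone unmatched in period `t` is stable among those who
match in period `t`, whatever the conjectures. -/
lemma stableAmongMatched_of_unmatched (P : Pref A B) (E : Economy A B) (m : PreMatching A B)
    (t : ℕ) (C : Agent A B → Set (PreMatching A B)) (mbar : PreMatching A B)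
    (hA : ∀ a, mbar.mA t a = none) (hB : ∀ b, mbar.mB t b = none) :
    StableAmongMatched P E m t C mbar := by
  simp [StableAmongMatched, hA, hB]

/-- A matching that leaves everyone unmatched in period `t` and has an admissible
continuation is a CVR conjecture. -/
lemma mem_cvrConj_of_unmatched (P : Pref A B) (DS : Economy A B → Set (PreMatching A B))
    (E : Economy A B) (t : ℕ) (m mbar : PreMatching A B) (k : Agent A B)
    (hA : ∀ a, mbar.mA t a = none) (hB : ∀ b, mbar.mB t b = none)
    (hm : mbar ∈ MSet E m t k)
    (hc : restrictM mbar (t + 1) ∈ DS (contEconomy E mbar (t + 1))) :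
    mbar ∈ cvrConj P DS E t m k := by
  refine Set.mem_iInter.2 fun n => ?_
  cases n with
  | zero => exact hm
  | succ n => exact ⟨hm, stableAmongMatched_of_unmatched P E m t _ mbar hA hB, hc⟩

/-- A matching that leaves everyone unmatched in period `t` and has an admissible
continuation is a dynamic-stability conjecture. -/
lemma mem_dsConj_of_unmatched (P : Pref A B) (DS : Economy A B → Set (PreMatching A B))
    (E : Economy A B) (t : ℕ) (m mbar : PreMatching A B) (k : Agent A B)
    (hA : ∀ a, mbar.mA t a = none) (hB : ∀ b, mbar.mB t b = none)
    (hm : mbar ∈ MSet E m t k)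
    (hc : restrictM mbar (t + 1) ∈ DS (contEconomy E mbar (t + 1))) :
    mbar ∈ dsConj P DS E t m k :=
  ⟨hm, by simp [hA], by simp [hB], by simp [hA], hc⟩

/-- The period-2 partner under `m^R`; the pairing is given by the same map on both sides. -/
def partnerR (i : Fin 4) : Fin 4 :=
  if i = 0 then 2 else if i = 1 then 3 else if i = 2 then 0 else 1

lemma mR_mA (t : ℕ) (a : Fin 4) :
    mR.mA t a = if t = 0 then none else some (partnerR a) := by
  simp only [mR, partnerR]
  split_ifs <;> rfl

lemma mR_mB (t : ℕ) (b : Fin 4) :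
    mR.mB t b = if t = 0 then none else some (partnerR b) := by
  simp only [mR, partnerR]
  split_ifs <;> rfl

lemma partnerR_eq_iff (a b : Fin 4) : partnerR a = b ↔ partnerR b = a := by
  revert a b; decide

lemma mem_arrAUpTo_one (a : Fin 4) : a ∈ arrAUpTo E2econ 1 := by
  revert a; decide

lemma mem_arrBUpTo_one (b : Fin 4) : b ∈ arrBUpTo E2econ 1 := by
  revert b; decide

lemma isMatching_mR : IsMatching E2econ mR := by
  have hT : E2econ.T = 2 := rfl
  refine ⟨fun t a b _ => ?_, fun t a ht h => ?_, fun t a b ht h => ?_,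
    fun t s a hts _ h => ?_, fun t s b hts _ h => ?_⟩
  · rw [mR_mA, mR_mB]
    split_ifs
    · simp
    · simpa using partnerR_eq_iff a b
  · rw [mR_mA] at h
    obtain rfl : t = 1 := by
      have : t ≠ 0 := by rintro rfl; simp at h
      omega
    exact mem_arrAUpTo_one a
  · rw [mR_mA] at h
    obtain rfl : t = 1 := by
      have : t ≠ 0 := by rintro rfl; simp at h
      omega
    exact mem_arrBUpTo_one b
  · rw [mR_mA] at h
    have : t ≠ 0 := by rintro rfl; simp at h
    rw [mR_mA, mR_mA, if_neg this, if_neg (by omega)]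
  · rw [mR_mB] at h
    have : t ≠ 0 := by rintro rfl; simp at h
    rw [mR_mB, mR_mB, if_neg this, if_neg (by omega)]

lemma isMatching_emptyM (E : Economy A B) : IsMatching E emptyM := by
  simp [IsMatching, emptyM]

lemma mR_mem_MSet (k : Agent (Fin 4) (Fin 4)) : mR ∈ MSet E2econ mR 0 k := by
  refine ⟨isMatching_mR, fun s hs => absurd hs (by omega), ?_⟩
  cases k with
  | inl a =>
    intro s hs
    rw [mR_mA, if_pos (by omega)]
  | inr b =>
    intro s hs
    rw [mR_mB, if_pos (by omega)]

lemma emptyM_mem_MSet (k : Agent (Fin 4) (Fin 4)) : emptyM ∈ MSet E2econ mR 1 k := by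
  refine ⟨isMatching_emptyM _, fun s hs => ?_, ?_⟩
  · obtain rfl : s = 0 := by omega
    exact ⟨fun _ => rfl, fun _ => rfl⟩
  · cases k <;> exact fun _ _ => rfl

lemma sInf_nonzero_ge {t : ℕ} (ht : t ≤ 1) : sInf {s : ℕ | t ≤ s ∧ s ≠ 0} = 1 := by
  refine le_antisymm (Nat.sInf_le ⟨ht, one_ne_zero⟩) ?_
  exact le_csInf ⟨1, ht, one_ne_zero⟩ fun s hs => Nat.one_le_iff_ne_zero.2 hs.2

lemma Upay_mR (P : Pref (Fin 4) (Fin 4)) {t : ℕ} (ht : t ≤ 1) (a : Fin 4) :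
    Upay P E2econ mR t a = P.dA a ^ (1 - t) * P.u a (partnerR a) := by
  have hm : matchTimeA E2econ mR t a = 1 := by
    have : ∀ s, mR.mA s a ≠ none ↔ s ≠ 0 := fun s => by rw [mR_mA]; split_ifs <;> simp_all
    simp only [matchTimeA, this, sInf_nonzero_ge ht]
    rfl
  have hp : mR.mA (E2econ.T - 1) a = some (partnerR a) := mR_mA 1 a
  simp only [Upay, hp, hm]

lemma Vpay_mR (P : Pref (Fin 4) (Fin 4)) {t : ℕ} (ht : t ≤ 1) (b : Fin 4) :
    Vpay P E2econ mR t b = P.dB b ^ (1 - t) * P.v (partnerR b) b := by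
  have hm : matchTimeB E2econ mR t b = 1 := by
    have : ∀ s, mR.mB s b ≠ none ↔ s ≠ 0 := fun s => by rw [mR_mB]; split_ifs <;> simp_all
    simp only [matchTimeB, this, sInf_nonzero_ge ht]
    rfl
  have hp : mR.mB (E2econ.T - 1) b = some (partnerR b) := mR_mB 1 b
  simp only [Vpay, hp, hm]

lemma restrictM_mR_mA (a : Fin 4) (s : ℕ) :
    (restrictM mR 1).mA s a = some (partnerR a) := by
  have h : ∀ s', s' < 1 → mR.mA s' a = none := fun s' hs => by
    rw [mR_mA, if_pos (by omega)]
  simp only [restrictM]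
  rw [if_pos h, mR_mA, if_neg (by omega)]

lemma restrictM_mR_mB (b : Fin 4) (s : ℕ) :
    (restrictM mR 1).mB s b = some (partnerR b) := by
  have h : ∀ s', s' < 1 → mR.mB s' b = none := fun s' hs => by
    rw [mR_mB, if_pos (by omega)]
  simp only [restrictM]
  rw [if_pos h, mR_mB, if_neg (by omega)]

/-- If `a` is matched to the same partner in every period, its payoff is undiscounted. -/
lemma Upay_of_forall_mA (P : Pref A B) (E : Economy A B) (m : PreMatching A B) (a : A) (b : B)
    (h : ∀ s, m.mA s a = some b) : Upay P E m 0 a = P.u a b := by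
  simp [Upay, matchTimeA, h]

/-- If `b` is matched to the same partner in every period, its payoff is undiscounted. -/
lemma Vpay_of_forall_mB (P : Pref A B) (E : Economy A B) (m : PreMatching A B) (a : A) (b : B)
    (h : ∀ s, m.mB s b = some a) : Vpay P E m 0 b = P.v a b := by
  simp [Vpay, matchTimeB, h]

lemma mem_availA_one (a : Fin 4) : a ∈ availA E2econ mR 1 :=
  Finset.mem_filter.2 ⟨mem_arrAUpTo_one a, fun s hs => by rw [mR_mA, if_pos (by omega)]⟩

lemma mem_availB_one (b : Fin 4) : b ∈ availB E2econ mR 1 :=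
  Finset.mem_filter.2 ⟨mem_arrBUpTo_one b, fun s hs => by rw [mR_mB, if_pos (by omega)]⟩

lemma eq_zero_or_one_of_mem_availA {a : Fin 4} (ha : a ∈ availA E2econ mR 0) :
    a = 0 ∨ a = 1 := by
  have h := (Finset.mem_filter.1 ha).1
  revert h; revert a; decide

lemma eq_zero_or_one_of_mem_availB {b : Fin 4} (hb : b ∈ availB E2econ mR 0) :
    b = 0 ∨ b = 1 := by
  have h := (Finset.mem_filter.1 hb).1
  revert h; revert b; decide

section Example

variable {P : Pref (Fin 4) (Fin 4)}

/-- The static pairing underlying `m^R` is individually rational. -/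
lemma partnerR_pos (hP : Ex2Pref P) (i : Fin 4) :
    0 < P.u i (partnerR i) ∧ 0 < P.v (partnerR i) i := by
  obtain ⟨-, -, -, h1, h2, h3, h4, k1, k2, k3, k4⟩ := hP
  fin_cases i <;> simp [partnerR] <;> constructor <;> linarith

/-- The static pairing underlying `m^R` has no blocking pair. -/
lemma partnerR_not_block (hP : Ex2Pref P) (a b : Fin 4) :
    ¬(P.u a b > P.u a (partnerR a) ∧ P.v a b > P.v (partnerR b) b) := by
  obtain ⟨-, -, -, h1, h2, h3, h4, k1, k2, k3, k4⟩ := hP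
  rintro ⟨hu, hv⟩
  fin_cases a <;> fin_cases b <;> simp [partnerR] at hu hv <;> linarith

/-- First-period side-`A` agents prefer waiting for their `m^R`-partner to matching with
a first-period side-`B` agent. -/
lemma lt_dA_mul_partnerR (hP : Ex2Pref P) {a b : Fin 4} (ha : a = 0 ∨ a = 1)
    (hb : b = 0 ∨ b = 1) : P.u a b < P.dA a * P.u a (partnerR a) := by
  obtain ⟨-, hd, -, h1, h2, -⟩ := hP
  refine (hd a ha).2 _ _ ?_
  rcases ha with rfl | rfl <;> rcases hb with rfl | rfl <;> simp [partnerR] <;> linarith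

/-- The continuation of `m^R` is statically stable. -/
lemma stable1_restrictM_mR (hP : Ex2Pref P) :
    Stable1 P (contEconomy E2econ mR 1) (restrictM mR 1) := by
  have hA : ∀ a s, a ∈ arrAUpTo (contEconomy E2econ mR 1) s := fun a s =>
    Finset.mem_biUnion.2 ⟨0, by simp, mem_availA_one a⟩
  have hB : ∀ b s, b ∈ arrBUpTo (contEconomy E2econ mR 1) s := fun b s =>
    Finset.mem_biUnion.2 ⟨0, by simp, mem_availB_one b⟩
  refine ⟨⟨fun t a b _ => ?_, fun t a _ _ => hA a t, fun t _ b _ _ => hB b t,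
    fun t s a _ _ _ => ?_, fun t s b _ _ _ => ?_⟩, fun a b h => ?_, fun b a h => ?_,
    fun a _ b _ => ?_⟩
  · rw [restrictM_mR_mA, restrictM_mR_mB]
    simpa using partnerR_eq_iff a b
  · rw [restrictM_mR_mA, restrictM_mR_mA]
  · rw [restrictM_mR_mB, restrictM_mR_mB]
  · rw [restrictM_mR_mA, Option.some_inj] at h
    exact h ▸ (partnerR_pos hP a).1.le
  · rw [restrictM_mR_mB, Option.some_inj] at h
    exact h ▸ (partnerR_pos hP b).2.le
  · rw [Upay_of_forall_mA P _ _ a _ (restrictM_mR_mA a),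
      Vpay_of_forall_mB P _ _ _ b (restrictM_mR_mB b)]
    exact partnerR_not_block hP a b

/-- `m^R` is a solution for every family of conjectures that contains `m^R` itself in
period 1 and the empty matching in period 2. -/
lemma isSolution_mR (hP : Ex2Pref P) (φ : ConjFam (Fin 4) (Fin 4))
    (h0 : ∀ k, mR ∈ φ 0 mR k) (h1 : ∀ k, emptyM ∈ φ 1 mR k) :
    IsSolution P E2econ φ mR := by
  refine ⟨isMatching_mR, fun t ht => ?_⟩
  have ht' : t < 2 := ht
  interval_cases t
  · refine ⟨fun a _ => ⟨mR, h0 _, le_rfl⟩, fun b _ => ⟨mR, h0 _, le_rfl⟩,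
      fun a ha b hb hab => ?_⟩
    have := lt_dA_mul_partnerR hP (eq_zero_or_one_of_mem_availA ha)
      (eq_zero_or_one_of_mem_availB hb)
    rw [Upay_mR P zero_le_one, tsub_zero, pow_one] at hab
    exact this.not_gt hab.1
  · simp only [Upay_mR P le_rfl, Vpay_mR P le_rfl, tsub_self, pow_zero, one_mul]
    exact ⟨fun a _ => ⟨emptyM, h1 _, (partnerR_pos hP a).1.le⟩,
      fun b _ => ⟨emptyM, h1 _, (partnerR_pos hP b).2.le⟩,
      fun a _ b _ => partnerR_not_block hP a b⟩

end Example

/-- in the Example-2 economy, `m^R` is CVR-dynamically stable, and hence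
also dynamically stable. -/
theorem statement18 (P : Pref (Fin 4) (Fin 4)) (hP : Ex2Pref P)
    (DSol DShat : Economy (Fin 4) (Fin 4) → Set (PreMatching (Fin 4) (Fin 4)))
    (hDSol : IsDSFamily P DSol) (hDShat : IsCVRFamily P DShat) :
    mR ∈ DShat E2econ ∧ mR ∈ DSol E2econ := by
  have hA : ∀ a, mR.mA 0 a = none := fun _ => rfl
  have hB : ∀ b, mR.mB 0 b = none := fun _ => rfl
  constructor
  · rw [hDShat.2.2 E2econ le_rfl]
    refine isSolution_mR hP _ (fun k => ?_) (fun k => ?_)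
    · refine mem_cvrConj_of_unmatched P DShat E2econ 0 mR mR k hA hB (mR_mem_MSet k) ?_
      rw [hDShat.2.1 _ rfl]
      exact stable1_restrictM_mR hP
    · refine mem_cvrConj_of_unmatched P DShat E2econ 1 mR emptyM k (fun _ => rfl)
        (fun _ => rfl) (emptyM_mem_MSet k) ?_
      rw [hDShat.1 _ rfl]
      trivial
  · rw [hDSol.2.2 E2econ le_rfl]
    refine isSolution_mR hP _ (fun k => ?_) (fun k => ?_)
    · refine mem_dsConj_of_unmatched P DSol E2econ 0 mR mR k hA hB (mR_mem_MSet k) ?_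
      rw [hDSol.2.1 _ rfl]
      exact stable1_restrictM_mR hP
    · refine mem_dsConj_of_unmatched P DSol E2econ 1 mR emptyM k (fun _ => rfl)
        (fun _ => rfl) (emptyM_mem_MSet k) ?_
      rw [hDSol.1 _ rfl]
      trivial

end

end DynMatch
end
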